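/- In the affine nil Hecke algebra H_ℓ, the identity Σ_{u=0}^{ℓ-1} (−1)^u ε_{ℓ-1-u}(x_2,…,x_ℓ) τ_{ℓ-1}τ_{ℓ-2}⋯τ_1 x_1^u e'_{[2,ℓ]} = e'_{[2,ℓ]} holds, where ε_j is the elementary symmetric polynomial of degree j in x_2,…,x_ℓ and e'_{[2,ℓ]} = τ_{ω_0[2,ℓ]} x'_{[2,ℓ]} is the idempotent with x'_{[2,ℓ]} = (−1)^{(ℓ-2)(ℓ-3)/2} x_2^{ℓ-2} x_3^{ℓ-3} ⋯ x_{ℓ-1}. -/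

import Mathlib

open MvPolynomial

/-- Generators of the affine nil Hecke algebra `H_n`: `x i` for `i : Fin n` and
`t k` for `k : Fin (n-1)` (so `t k` corresponds to `τ_{k+1}` in one-based notation). -/
inductive NHGen (n : ℕ) : Type
  | x : Fin n → NHGen n
  | t : Fin (n - 1) → NHGen n

namespace NHGen

/-- The image in `Fin n` of the smaller index of `t k`. -/
def lo {n : ℕ} (k : Fin (n - 1)) : Fin n := ⟨k.val, by have := k.isLt; omega⟩
/-- The image in `Fin n` of the larger index of `t k`. -/
def hi {n : ℕ} (k : Fin (n - 1)) : Fin n := ⟨k.val + 1, by have := k.isLt; omega⟩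

end NHGen

/-- The defining relations of the affine nil Hecke algebra. -/
inductive NHRel (K : Type) [Field K] (n : ℕ) :
    FreeAlgebra K (NHGen n) → FreeAlgebra K (NHGen n) → Prop
  | xx (i j : Fin n) : NHRel K n
      (FreeAlgebra.ι K (NHGen.x i) * FreeAlgebra.ι K (NHGen.x j))
      (FreeAlgebra.ι K (NHGen.x j) * FreeAlgebra.ι K (NHGen.x i))
  | tsq (k : Fin (n - 1)) : NHRel K n
      (FreeAlgebra.ι K (NHGen.t k) * FreeAlgebra.ι K (NHGen.t k)) 0
  | tx (k : Fin (n - 1)) (i : Fin n) : NHRel K n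
      (FreeAlgebra.ι K (NHGen.t k) * FreeAlgebra.ι K (NHGen.x i) -
        FreeAlgebra.ι K (NHGen.x (Equiv.swap (NHGen.lo k) (NHGen.hi k) i)) *
          FreeAlgebra.ι K (NHGen.t k))
      ((if i = NHGen.hi k then 1 else 0) - (if i = NHGen.lo k then 1 else 0))
  | tt (k l : Fin (n - 1)) (h : k.val + 1 < l.val) : NHRel K n
      (FreeAlgebra.ι K (NHGen.t k) * FreeAlgebra.ι K (NHGen.t l))
      (FreeAlgebra.ι K (NHGen.t l) * FreeAlgebra.ι K (NHGen.t k))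
  | braid (k l : Fin (n - 1)) (h : l.val = k.val + 1) : NHRel K n
      (FreeAlgebra.ι K (NHGen.t l) * FreeAlgebra.ι K (NHGen.t k) * FreeAlgebra.ι K (NHGen.t l))
      (FreeAlgebra.ι K (NHGen.t k) * FreeAlgebra.ι K (NHGen.t l) * FreeAlgebra.ι K (NHGen.t k))

/-- The affine nil Hecke algebra `H_n` over `K`, presented by generators and relations. -/
def NilHecke (K : Type) [Field K] (n : ℕ) : Type := RingQuot (NHRel K n)

noncomputable instance (K : Type) [Field K] (n : ℕ) : Ring (NilHecke K n) :=
  inferInstanceAs (Ring (RingQuot (NHRel K n)))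

noncomputable instance (K : Type) [Field K] (n : ℕ) : Algebra K (NilHecke K n) :=
  inferInstanceAs (Algebra K (RingQuot (NHRel K n)))

/-- The generator `x_{i+1}` of `H_n` (zero-based index `i`). -/
noncomputable def xgen {K : Type} [Field K] {n : ℕ} (i : Fin n) : NilHecke K n :=
  RingQuot.mkAlgHom K (NHRel K n) (FreeAlgebra.ι K (NHGen.x i))

/-- The generator `τ_{k+1}` of `H_n` (zero-based index `k`). -/
noncomputable def tgen {K : Type} [Field K] {n : ℕ} (k : Fin (n - 1)) : NilHecke K n :=
  RingQuot.mkAlgHom K (NHRel K n) (FreeAlgebra.ι K (NHGen.t k))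

open NHGen in
/-- The product of the simple transpositions along a word `L`. -/
def wordProd {n : ℕ} (L : List (Fin (n - 1))) : Equiv.Perm (Fin n) :=
  (L.map (fun k => Equiv.swap (lo k) (hi k))).prod

/-- The number of inversions of a permutation, i.e. its Coxeter length. -/
def invCount {n : ℕ} (σ : Equiv.Perm (Fin n)) : ℕ :=
  (Finset.univ.filter (fun p : Fin n × Fin n => p.1 < p.2 ∧ σ p.2 < σ p.1)).card

/-- The product `τ_{i_1} ⋯ τ_{i_r}` in `H_n` along a word `L = [i_1, …, i_r]`. -/
noncomputable def tauProd {K : Type} [Field K] {n : ℕ} (L : List (Fin (n - 1))) :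
    NilHecke K n :=
  (L.map tgen).prod

/-- The descending product `t (a + r - 1) * ⋯ * t (a + 1) * t a`. -/
def descProd {M : Type*} [Monoid M] (t : ℕ → M) (a : ℕ) : ℕ → M
  | 0 => 1
  | r + 1 => t (a + r) * descProd t a r

theorem descProd_succ' {M : Type*} [Monoid M] (t : ℕ → M) (a r : ℕ) :
    descProd t a (r + 1) = descProd t (a + 1) r * t a := by
  induction r with
  | zero => simp [descProd]
  | succ r ih =>
    rw [descProd, ih, descProd, mul_assoc, show a + (r + 1) = a + 1 + r by omega]

theorem commute_descProd {M : Type*} [Monoid M] {t : ℕ → M} {a r : ℕ} {y : M}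
    (h : ∀ i, a ≤ i → i < a + r → Commute y (t i)) : Commute y (descProd t a r) := by
  induction r with
  | zero => exact Commute.one_right y
  | succ r ih =>
    exact (h _ (by omega) (by omega)).mul_right (ih fun i h₁ h₂ => h i h₁ (by omega))

/-- The relations of the nil Coxeter monoid (with zero) of type `A_∞`. -/
structure IsNilCoxeter {M : Type*} [MonoidWithZero M] (t : ℕ → M) : Prop where
  sq : ∀ i, t i * t i = 0
  comm : ∀ i j, i + 1 < j → t i * t j = t j * t i
  braid : ∀ i, t (i + 1) * t i * t (i + 1) = t i * t (i + 1) * t i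

namespace IsNilCoxeter

variable {M : Type*} [MonoidWithZero M] {t : ℕ → M}

theorem shift (ht : IsNilCoxeter t) : IsNilCoxeter fun i => t (i + 1) where
  sq i := ht.sq _
  comm i j h := ht.comm _ _ (by omega)
  braid i := ht.braid _

theorem commute (ht : IsNilCoxeter t) {i j : ℕ} (h : i + 1 < j ∨ j + 1 < i) :
    Commute (t i) (t j) := by
  rcases h with h | h
  · exact ht.comm i j h
  · exact (ht.comm j i h).symm

theorem descProd_mul_of_mem (ht : IsNilCoxeter t) {a r k : ℕ} (h₁ : a ≤ k)
    (h₂ : k + 1 < a + r) : descProd t a r * t (k + 1) = t k * descProd t a r := by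
  induction r with
  | zero => omega
  | succ r ih =>
    rcases Nat.lt_or_ge (k + 1) (a + r) with h | h
    · rw [descProd, mul_assoc, ih h, ← mul_assoc, ← mul_assoc,
        (ht.commute (Or.inl h)).eq]
    · obtain ⟨q, rfl⟩ : ∃ q, r = q + 1 := ⟨r - 1, by omega⟩
      obtain rfl : k = a + q := by omega
      have hc : Commute (t (a + q + 1)) (descProd t a q) :=
        commute_descProd fun i _ _ => ht.commute (by omega)
      calc descProd t a (q + 1 + 1) * t (a + q + 1)
          = t (a + q + 1) * t (a + q) * (descProd t a q * t (a + q + 1)) := by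
            simp only [descProd, mul_assoc, add_assoc]
        _ = t (a + q + 1) * t (a + q) * t (a + q + 1) * descProd t a q := by
            rw [← hc.eq, mul_assoc _ (t (a + q + 1))]
        _ = t (a + q) * descProd t a (q + 1 + 1) := by
            rw [ht.braid]
            simp only [descProd, mul_assoc, add_assoc]

theorem prod_eq_zero_or_exists (ht : IsNilCoxeter t) (p : ℕ) (L : List ℕ)
    (hL : ∀ k ∈ L, k < p + 1) :
    (L.map t).prod = 0 ∨ ∃ L' : List ℕ, ∃ a r : ℕ, (∀ k ∈ L', k < p) ∧ a + r = p + 1 ∧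
      L'.length + r = L.length ∧ (L.map t).prod = (L'.map t).prod * descProd t a r := by
  induction L using List.reverseRecOn with
  | nil => exact Or.inr ⟨[], p + 1, 0, by simp, by simp, by simp, by simp [descProd]⟩
  | append_singleton L k ih =>
    have hk : k < p + 1 := hL k (by simp)
    rcases ih fun i hi => hL i (by simp [hi]) with h0 | ⟨L', a, r, hL', har, hlen, hprod⟩
    · left; simp [h0]
    have hstep : ((L ++ [k]).map t).prod = (L'.map t).prod * (descProd t a r * t k) := by
      simp [hprod, mul_assoc]
    have hmove : ∀ j < p, descProd t a r * t k = t j * descProd t a r →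
        ∃ L'' : List ℕ, ∃ a r : ℕ, (∀ k ∈ L'', k < p) ∧ a + r = p + 1 ∧
          L''.length + r = (L ++ [k]).length ∧
          ((L ++ [k]).map t).prod = (L''.map t).prod * descProd t a r := by
      intro j hj he
      refine ⟨L' ++ [j], a, r, ?_, har, ?_, ?_⟩
      · intro i hi
        rcases List.mem_append.1 hi with hi | hi
        · exact hL' i hi
        · obtain rfl := List.mem_singleton.1 hi
          exact hj
      · simp only [List.length_append, List.length_singleton]; omega
      · rw [hstep, he]; simp [mul_assoc]
    rcases lt_trichotomy k a with h | rfl | h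
    · right
      rcases Nat.lt_or_ge (k + 1) a with h' | h'
      · exact hmove k (by omega)
          (commute_descProd fun i _ _ => ht.commute (by omega)).eq.symm
      · obtain rfl : a = k + 1 := by omega
        refine ⟨L', k, r + 1, hL', by omega, ?_, ?_⟩
        · simp only [List.length_append, List.length_singleton]; omega
        · rw [hstep, descProd_succ']
    · left
      obtain ⟨q, rfl⟩ : ∃ q, r = q + 1 := ⟨r - 1, by omega⟩
      rw [hstep, descProd_succ', mul_assoc (descProd _ _ _), ht.sq, mul_zero, mul_zero]
    · right
      obtain ⟨j, rfl⟩ : ∃ j, k = j + 1 := ⟨k - 1, by omega⟩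
      exact hmove j (by omega) (ht.descProd_mul_of_mem (by omega) (by omega))

/-- A word in `p` letters longer than the longest element of the symmetric group `S_{p+1}`
has vanishing product. -/
theorem prod_eq_zero (ht : IsNilCoxeter t) (p : ℕ) (L : List ℕ) (hL : ∀ k ∈ L, k < p)
    (hlen : p * (p + 1) < 2 * L.length) : (L.map t).prod = 0 := by
  induction p generalizing L with
  | zero =>
    cases L with
    | nil => simp at hlen
    | cons k L => exact absurd (hL k (by simp)) (by omega)
  | succ p ih =>
    rcases ht.prod_eq_zero_or_exists p L hL with h | ⟨L', a, r, hL', har, hl, hprod⟩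
    · exact h
    · rw [hprod, ih L' hL' (by nlinarith), zero_mul]

end IsNilCoxeter

section

variable {K : Type} [Field K] {N : ℕ}

/-- The generators `tgen` extended by zero to a sequence indexed by `ℕ`. -/
noncomputable def tseq (K : Type) [Field K] (N i : ℕ) : NilHecke K (N + 1) :=
  if h : i < N then tgen (⟨i, h⟩ : Fin (N + 1 - 1)) else 0

theorem tseq_val (k : Fin (N + 1 - 1)) : tseq K N k.val = tgen k := by
  have h : k.val < N := k.isLt
  simp [tseq, h]

theorem isNilCoxeter_tseq : IsNilCoxeter (tseq K N) where
  sq i := by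
    by_cases h : i < N
    · have := RingQuot.mkAlgHom_rel K (NHRel.tsq (K := K) (⟨i, h⟩ : Fin (N + 1 - 1)))
      rw [map_mul, map_zero] at this
      simp only [tseq, h, dite_true]
      exact this
    · simp [tseq, h]
  comm i j hij := by
    by_cases h : j < N
    · have hi : i < N := by omega
      have := RingQuot.mkAlgHom_rel K
        (NHRel.tt (K := K) (⟨i, hi⟩ : Fin (N + 1 - 1)) ⟨j, h⟩ hij)
      rw [map_mul, map_mul] at this
      simp only [tseq, h, hi, dite_true]
      exact this
    · simp [tseq, h]
  braid i := by
    by_cases h : i + 1 < N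
    · have hi : i < N := by omega
      have := RingQuot.mkAlgHom_rel K
        (NHRel.braid (K := K) (⟨i, hi⟩ : Fin (N + 1 - 1)) ⟨i + 1, h⟩ rfl)
      simp only [map_mul] at this
      simp only [tseq, h, hi, dite_true]
      exact this
    · simp [tseq, h]

theorem tgen_mul_xgen {n : ℕ} (k : Fin (n - 1)) (i : Fin n) :
    (tgen k * xgen i : NilHecke K n) =
      xgen (Equiv.swap (NHGen.lo k) (NHGen.hi k) i) * tgen k +
        ((if i = NHGen.hi k then 1 else 0) - (if i = NHGen.lo k then 1 else 0)) := by
  have := RingQuot.mkAlgHom_rel K (NHRel.tx (K := K) k i)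
  simp only [map_sub, map_mul, apply_ite (RingQuot.mkAlgHom K (NHRel K n)), map_one,
    map_zero] at this
  exact sub_eq_iff_eq_add'.1 this

theorem commute_tgen_xgen {n : ℕ} {k : Fin (n - 1)} {i : Fin n} (hlo : i ≠ NHGen.lo k)
    (hhi : i ≠ NHGen.hi k) : Commute (tgen k : NilHecke K n) (xgen i) := by
  have := tgen_mul_xgen (K := K) k i
  rw [Equiv.swap_apply_of_ne_of_ne hlo hhi] at this
  simpa [hlo, hhi, Commute, SemiconjBy] using this

theorem tseq_mul_xgen {m : ℕ} (hm : m < N) :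
    tseq K N m * xgen (⟨m, by omega⟩ : Fin (N + 1)) =
      xgen (⟨m + 1, by omega⟩ : Fin (N + 1)) * tseq K N m - 1 := by
  have := tgen_mul_xgen (K := K) (n := N + 1) (⟨m, hm⟩ : Fin (N + 1 - 1)) ⟨m, by omega⟩
  simpa [tseq, hm, NHGen.lo, NHGen.hi, sub_eq_add_neg] using this

theorem prod_finRange_reverse_tgen :
    ((List.finRange N).reverse.map
      (fun k => (tgen (show Fin (N + 1 - 1) from k) : NilHecke K (N + 1)))).prod =
      descProd (tseq K N) 0 N := by
  have h : (List.finRange N).map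
      (fun k => (tgen (show Fin (N + 1 - 1) from k) : NilHecke K (N + 1))) =
      (List.range N).map (tseq K N) := by
    rw [← List.map_coe_finRange_eq_range, List.map_map]
    exact List.map_congr_left fun k _ => (tseq_val (N := N) k).symm
  have hd : ∀ m, ((List.range m).map (tseq K N)).reverse.prod = descProd (tseq K N) 0 m := by
    intro m
    induction m with
    | zero => simp [descProd]
    | succ m ih => simp [List.range_succ, descProd, ih]
  rw [List.map_reverse, h, hd]

theorem tseq_mul_tauProd (L : List (Fin (N + 1 - 1))) (hmem : ∀ j ∈ L, 1 ≤ j.val)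
    (hlen : L.length = N * (N - 1) / 2) {j : ℕ} (hj : 1 ≤ j) :
    tseq K N j * tauProd L = 0 := by
  by_cases h : j < N
  · have hL : (tauProd L : NilHecke K (N + 1)) =
        ((L.map fun k => k.val - 1).map fun i => tseq K N (i + 1)).prod := by
      rw [tauProd, List.map_map]
      congr 1
      refine List.map_congr_left fun k hk => ?_
      have := hmem k hk
      simp only [Function.comp_apply, Nat.sub_add_cancel this, tseq_val]
    have h0 := (isNilCoxeter_tseq (K := K) (N := N)).shift.prod_eq_zero (N - 1)
      ((j - 1) :: L.map fun k => k.val - 1) (by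
        intro i hi
        rcases List.mem_cons.1 hi with rfl | hi
        · omega
        · obtain ⟨k, hk, rfl⟩ := List.mem_map.1 hi
          have h₁ := hmem k hk
          have h₂ : k.val < N := k.isLt
          omega) (by
        have he := Nat.two_mul_div_two_of_even (Nat.even_mul_pred_self N)
        rw [List.length_cons, List.length_map, hlen, Nat.sub_add_cancel (by omega),
          mul_comm (N - 1) N]
        omega)
    rw [List.map_cons, List.prod_cons, ← hL, Nat.sub_add_cancel hj] at h0
    exact h0
  · simp [tseq, h]

theorem descProd_mul_xgen_zero {Y : NilHecke K (N + 1)} (hY : ∀ j, 1 ≤ j → tseq K N j * Y = 0)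
    {m : ℕ} (hm : m < N) :
    descProd (tseq K N) 0 (m + 1) * xgen (0 : Fin (N + 1)) * Y =
      xgen (⟨m + 1, by omega⟩ : Fin (N + 1)) * (descProd (tseq K N) 0 (m + 1) * Y) -
        descProd (tseq K N) 0 m * Y := by
  induction m with
  | zero =>
    have h := tseq_mul_xgen (K := K) hm
    simp only [descProd, mul_one, zero_add] at h ⊢
    rw [show (0 : Fin (N + 1)) = ⟨0, by omega⟩ from rfl, h, sub_mul, one_mul, mul_assoc]
  | succ m ih =>
    have hc : Commute (tseq K N (m + 1)) (descProd (tseq K N) 0 m) :=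
      commute_descProd fun i _ _ => isNilCoxeter_tseq.commute (by omega)
    have h0 : tseq K N (m + 1) * (descProd (tseq K N) 0 m * Y) = 0 := by
      rw [← mul_assoc, hc.eq, mul_assoc, hY _ (by omega), mul_zero]
    rw [descProd, zero_add, mul_assoc, mul_assoc, ← mul_assoc (descProd _ _ _), ih (by omega),
      mul_sub, h0, sub_zero, ← mul_assoc, tseq_mul_xgen hm, sub_mul, one_mul, mul_assoc, mul_assoc]

/-- The `K`-algebra map sending `c * X ^ u` to the operator `y ↦ ι c * y * (-z) ^ u`. -/
noncomputable def bimoduleEval {A H : Type*} [CommRing A] [Ring H] [Algebra K A] [Algebra K H]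
    (ι : A →ₐ[K] H) (z : H) : Polynomial A →+* Module.End K H :=
  Polynomial.eval₂RingHom' ((Algebra.lmul K H).comp ι : A →+* Module.End K H)
    (-LinearMap.mulRight K z) fun a => by
      refine LinearMap.ext fun y => ?_
      simp [mul_assoc]

theorem bimoduleEval_C {A H : Type*} [CommRing A] [Ring H] [Algebra K A] [Algebra K H]
    (ι : A →ₐ[K] H) (z : H) (c : A) :
    bimoduleEval ι z (Polynomial.C c) = LinearMap.mulLeft K (ι c) :=
  Polynomial.eval₂_C _ _

theorem bimoduleEval_X {A H : Type*} [CommRing A] [Ring H] [Algebra K A] [Algebra K H]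
    (ι : A →ₐ[K] H) (z : H) :
    bimoduleEval ι z Polynomial.X = -LinearMap.mulRight K z :=
  Polynomial.eval₂_X _ _

theorem mulRight_neg_pow_apply {H : Type*} [Ring H] [Algebra K H] (z y : H) (u : ℕ) :
    ((-LinearMap.mulRight K z) ^ u) y = (-1) ^ u * (y * z ^ u) := by
  induction u with
  | zero => simp
  | succ u ih =>
    rw [pow_succ', Module.End.mul_apply, ih]
    simp [pow_succ, mul_assoc]

theorem bimoduleEval_C_mul_X_pow {A H : Type*} [CommRing A] [Ring H] [Algebra K A] [Algebra K H]
    (ι : A →ₐ[K] H) (z y : H) (c : A) (u : ℕ) :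
    bimoduleEval ι z (Polynomial.C c * Polynomial.X ^ u) y =
      (-1) ^ u * ι c * (y * z ^ u) := by
  rw [map_mul, map_pow, bimoduleEval_C, bimoduleEval_X, Module.End.mul_apply,
    mulRight_neg_pow_apply]
  simp [← mul_assoc, ((Commute.neg_one_left (ι c)).pow_left u).eq]

theorem bimoduleEval_X_add_C {A H : Type*} [CommRing A] [Ring H] [Algebra K A] [Algebra K H]
    (ι : A →ₐ[K] H) (z y : H) (c : A) :
    bimoduleEval ι z (Polynomial.X + Polynomial.C c) y = ι c * y - y * z := by
  simp [bimoduleEval_C, bimoduleEval_X, sub_eq_neg_add]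

theorem bimoduleEval_prod_descProd (ι : MvPolynomial (Fin (N + 1)) K →ₐ[K] NilHecke K (N + 1))
    (hι : ∀ i, ι (MvPolynomial.X i) = xgen i) {Y : NilHecke K (N + 1)}
    (hY : ∀ j, 1 ≤ j → tseq K N j * Y = 0) (hx : Commute Y (xgen (0 : Fin (N + 1)))) {m : ℕ}
    (hm : m ≤ N) :
    bimoduleEval ι (xgen 0)
      (∏ i ∈ (Finset.univ : Finset (Fin m)),
        (Polynomial.X + Polynomial.C (MvPolynomial.X (Fin.castLE hm i).succ)))
      (descProd (tseq K N) 0 m * Y) = Y := by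
  induction m with
  | zero => simp [descProd]
  | succ m ih =>
    rw [Fin.prod_univ_castSucc, map_mul (bimoduleEval ι (xgen 0)), Module.End.mul_apply, bimoduleEval_X_add_C, hι,
      mul_assoc _ Y, hx.eq, ← mul_assoc _ (xgen 0), descProd_mul_xgen_zero hY hm]
    exact (congrArg _ (sub_sub_cancel (_ : NilHecke K (N + 1)) _)).trans (ih (by omega))

end

/-- In the affine nil Hecke algebra `H_ℓ` (written with `ℓ = n` here),
`Σ_{u=0}^{ℓ-1} (−1)^u ε_{ℓ-1-u}(x_2,…,x_ℓ) τ_{ℓ-1}⋯τ_1 x_1^u e'_{[2,ℓ]} = e'_{[2,ℓ]}`,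
where `e'_{[2,ℓ]} = τ_{ω₀[2,ℓ]} x'_{[2,ℓ]}` with
`x'_{[2,ℓ]} = (−1)^{(ℓ-2)(ℓ-3)/2} x_2^{ℓ-2} x_3^{ℓ-3} ⋯ x_{ℓ-1}`, `ε_j` is the
elementary symmetric polynomial of degree `j` in `x_2,…,x_ℓ`, `ι` is the embedding of
the polynomial subalgebra of `H_ℓ`, and `τ_{ω₀[2,ℓ]}` is given by any reduced word `L₀`
for the longest element of the subgroup generated by `s_2,…,s_{ℓ-1}` (one-based), i.e.
with entries of zero-based index `≥ 1` and of length `(ℓ-1)(ℓ-2)/2`. -/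
theorem nilHecke_symmetrizer_identity (K : Type) [Field K] (n : ℕ) (hn : 1 ≤ n)
    (ι : MvPolynomial (Fin n) K →ₐ[K] NilHecke K n)
    (hι : ∀ i, ι (MvPolynomial.X i) = xgen i)
    (L₀ : List (Fin (n - 1)))
    (hL₀mem : ∀ j ∈ L₀, 1 ≤ j.val)
    (hL₀len : L₀.length = (n - 1) * (n - 2) / 2)
    (hL₀red : invCount (wordProd L₀) = L₀.length) :
    ∑ u ∈ Finset.range n,
      (-1 : NilHecke K n) ^ u *
        ι (∑ s ∈ Finset.powersetCard (n - 1 - u)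
            ((Finset.univ : Finset (Fin n)).filter (fun i => i ≠ ⟨0, by omega⟩)),
            ∏ i ∈ s, MvPolynomial.X i) *
        ((List.finRange (n - 1)).reverse.map tgen).prod *
        (xgen (⟨0, by omega⟩ : Fin n) : NilHecke K n) ^ u *
        (tauProd L₀ *
          ((-1 : NilHecke K n) ^ ((n - 2) * (n - 3) / 2) *
            ((List.finRange n).map
              (fun j => if j.val = 0 then 1 else (xgen j : NilHecke K n) ^ (n - 1 - j.val))).prod)) =
    tauProd L₀ *
      ((-1 : NilHecke K n) ^ ((n - 2) * (n - 3) / 2) *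
        ((List.finRange n).map
          (fun j => if j.val = 0 then 1 else (xgen j : NilHecke K n) ^ (n - 1 - j.val))).prod) := by
  obtain ⟨N, rfl⟩ : ∃ N, n = N + 1 := ⟨n - 1, by omega⟩
  have hY : ∀ j, 1 ≤ j → tseq K N j * tauProd L₀ = 0 :=
    fun j hj => tseq_mul_tauProd L₀ hL₀mem hL₀len hj
  have hx : Commute (tauProd L₀) (xgen (0 : Fin (N + 1)) : NilHecke K (N + 1)) := by
    refine Commute.list_prod_left _ _ fun y hy => ?_
    obtain ⟨k, hk, rfl⟩ := List.mem_map.1 hy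
    have h := hL₀mem k hk
    refine commute_tgen_xgen ?_ ?_ <;> simp only [NHGen.lo, NHGen.hi, ne_eq, Fin.ext_iff,
      Fin.val_zero] <;> omega
  set S : Finset (Fin (N + 1)) := Finset.univ.filter (fun i => i ≠ ⟨0, by omega⟩) with hS
  have hcard : S.card = N := by
    rw [hS, Finset.filter_ne', Finset.card_erase_of_mem (Finset.mem_univ _)]
    simp
  have hprod : ∏ i ∈ S, (Polynomial.X + Polynomial.C (MvPolynomial.X i :
        MvPolynomial (Fin (N + 1)) K)) =
      ∏ i : Fin N, (Polynomial.X + Polynomial.C (MvPolynomial.X i.succ)) := by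
    rw [hS, Finset.prod_filter, Fin.prod_univ_succ]
    simp [Fin.ext_iff]
  have hexp : ∏ i ∈ S, (Polynomial.X + Polynomial.C (MvPolynomial.X i :
        MvPolynomial (Fin (N + 1)) K)) =
      ∑ u ∈ Finset.range (N + 1), Polynomial.C (∑ s ∈ Finset.powersetCard (N - u) S,
        ∏ i ∈ s, MvPolynomial.X i) * Polynomial.X ^ u := by
    have h := Multiset.prod_X_add_C_eq_sum_esymm
      (S.val.map (MvPolynomial.X : Fin (N + 1) → MvPolynomial (Fin (N + 1)) K))
    rw [Multiset.map_map, Multiset.card_map, Finset.card_val, hcard] at h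
    rw [← Finset.sum_range_reflect]
    refine h.trans (Finset.sum_congr rfl fun u hu => ?_)
    have hu' : u ≤ N := Nat.lt_succ_iff.1 (Finset.mem_range.1 hu)
    rw [Finset.esymm_map_val, show N + 1 - 1 - u = N - u by omega, Nat.sub_sub_self hu']
  have hmain := bimoduleEval_prod_descProd ι hι hY hx le_rfl
  simp only [Fin.castLE_rfl, id] at hmain
  rw [← hprod, hexp, map_sum, LinearMap.sum_apply] at hmain
  conv_rhs => rw [← hmain]
  rw [Finset.sum_mul]
  refine Finset.sum_congr rfl fun u _ => ?_
  rw [bimoduleEval_C_mul_X_pow, ← prod_finRange_reverse_tgen, mul_assoc _ (tauProd L₀),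
    (hx.pow_right u).eq]
  simp only [mul_assoc]
  rfl
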